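/- (Sub-additivity on the risk-tail region.) Let X and Y be integrable random variables with S(U_β^φ(X)) = 1 and S(U_β^φ(Y)) = 1. Then SlideVaR_{α,β}^φ(X + Y) ≤ SlideVaR_{α,β}^φ(X) + SlideVaR_{α,β}^φ(Y). -/

import Mathlib

open MeasureTheory

/-- Quantile function `F_X^{-1}(p) = inf {x : F_X(x) >= p}` of the loss `X` under `P`. -/
noncomputable def quantile {Ω : Type*} [MeasurableSpace Ω] (P : Measure Ω)
    (X : Ω → ℝ) (p : ℝ) : ℝ :=
  sInf {x : ℝ | p ≤ (P {ω | X ω ≤ x}).toReal}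

/-- Tail thickness `U_β^φ(X) = ∫_0^1 F_X^{-1}(p) φ_β(p) dp`. -/
noncomputable def tailThickness {Ω : Type*} [MeasurableSpace Ω] (P : Measure Ω)
    (φ : ℝ → ℝ) (X : Ω → ℝ) : ℝ :=
  ∫ p in (0:ℝ)..1, quantile P X p * φ p

/-- Value at risk `VaR_α(X) = F_X^{-1}(α)`. -/
noncomputable def VaR {Ω : Type*} [MeasurableSpace Ω] (P : Measure Ω)
    (α : ℝ) (X : Ω → ℝ) : ℝ :=
  quantile P X α

/-- Conditional value at risk `CVaR_α(X) = (1/(1-α)) ∫_α^1 F_X^{-1}(p) dp`. -/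
noncomputable def CVaR {Ω : Type*} [MeasurableSpace Ω] (P : Measure Ω)
    (α : ℝ) (X : Ω → ℝ) : ℝ :=
  (1 / (1 - α)) * ∫ p in α..1, quantile P X p

/-- `SlideVaR_{α,β}^φ(X) = S(U_β^φ(X))·CVaR_α(X) + (1 - S(U_β^φ(X)))·VaR_β(X)`. -/
noncomputable def SlideVaR {Ω : Type*} [MeasurableSpace Ω] (P : Measure Ω)
    (α β : ℝ) (φ S : ℝ → ℝ) (X : Ω → ℝ) : ℝ :=
  S (tailThickness P φ X) * CVaR P α X
    + (1 - S (tailThickness P φ X)) * VaR P β X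

section Quantile

open Set Filter Topology ProbabilityTheory

variable {Ω : Type*} [MeasurableSpace Ω] {P : Measure Ω} {X Y : Ω → ℝ} {α : ℝ}

lemma CVaR_eq (hα : α < 1) :
    CVaR P α X = (1 / (1 - α)) * ∫ p in Ioo α 1, quantile P X p := by
  rw [CVaR, intervalIntegral.integral_of_le hα.le, integral_Ioc_eq_integral_Ioo]

lemma setIntegral_const_Ioo (hα : α < 1) (t : ℝ) : ∫ _ in Ioo α 1, t = (1 - α) * t := by
  simp [hα.le]

variable [IsProbabilityMeasure P]

lemma toReal_measure_le_eq_cdf (hX : AEMeasurable X P) (x : ℝ) :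
    (P {ω | X ω ≤ x}).toReal = cdf (P.map X) x := by
  have := Measure.isProbabilityMeasure_map hX
  rw [cdf_eq_real, measureReal_def, Measure.map_apply_of_aemeasurable hX measurableSet_Iic]
  rfl

lemma quantile_eq_sInf_cdf (hX : AEMeasurable X P) (p : ℝ) :
    quantile P X p = sInf {x | p ≤ cdf (P.map X) x} := by
  simp only [quantile, toReal_measure_le_eq_cdf hX]

/-- The quantile function is the lower adjoint of the cumulative distribution function. -/
lemma quantile_le_iff (hX : AEMeasurable X P) {p : ℝ} (hp : p ∈ Ioo (0 : ℝ) 1) (x : ℝ) :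
    quantile P X p ≤ x ↔ p ≤ cdf (P.map X) x := by
  rw [quantile_eq_sInf_cdf hX]
  set F := cdf (P.map X)
  have hne : {x | p ≤ F x}.Nonempty :=
    (((tendsto_cdf_atTop (P.map X)).eventually (lt_mem_nhds hp.2)).exists).imp fun _ h => h.le
  have hbdd : BddBelow {x | p ≤ F x} := by
    obtain ⟨a, ha⟩ := ((tendsto_cdf_atBot (P.map X)).eventually (gt_mem_nhds hp.1)).exists
    refine ⟨a, fun y hy => ?_⟩
    by_contra! h
    exact absurd (hy.trans (F.mono h.le)) (not_le.2 ha)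
  refine ⟨fun h => ?_, fun h => csInf_le hbdd h⟩
  have hlim : Tendsto F (𝓝[>] x) (𝓝 (F x)) :=
    (F.right_continuous x).tendsto.mono_left (nhdsWithin_mono _ Ioi_subset_Ici_self)
  refine ge_of_tendsto hlim ?_
  filter_upwards [self_mem_nhdsWithin] with y hy
  obtain ⟨s, hs, hsy⟩ := exists_lt_of_csInf_lt hne (h.trans_lt hy)
  exact le_trans hs (F.mono hsy.le)

lemma monotoneOn_quantile (hX : AEMeasurable X P) : MonotoneOn (quantile P X) (Ioo 0 1) :=
  fun _ hp _ hq hpq =>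
    (quantile_le_iff hX hp _).2 (hpq.trans ((quantile_le_iff hX hq _).1 le_rfl))

lemma aemeasurable_quantile (hX : AEMeasurable X P) :
    AEMeasurable (quantile P X) (volume.restrict (Ioo 0 1)) :=
  aemeasurable_restrict_of_monotoneOn measurableSet_Ioo (monotoneOn_quantile hX)

/-- Inverse transform sampling: the quantile function of a uniform variable has the law of `X`. -/
lemma map_quantile (hX : AEMeasurable X P) :
    (volume.restrict (Ioo (0 : ℝ) 1)).map (quantile P X) = P.map X := by
  have := Measure.isProbabilityMeasure_map hX
  have hq := aemeasurable_quantile hX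
  refine Measure.ext_of_Iic _ _ fun x => ?_
  have h0 : 0 ≤ cdf (P.map X) x := cdf_nonneg _ _
  have h1 : cdf (P.map X) x ≤ 1 := cdf_le_one _ _
  have hset : quantile P X ⁻¹' Iic x ∩ Ioo 0 1 = Iic (cdf (P.map X) x) ∩ Ioo 0 1 := by
    ext p
    simp only [mem_inter_iff, mem_preimage, mem_Iic, and_congr_left_iff]
    exact fun hp => quantile_le_iff hX hp x
  rw [Measure.map_apply_of_aemeasurable hq measurableSet_Iic,
    Measure.restrict_apply' measurableSet_Ioo, hset, ← ofReal_cdf]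
  refine le_antisymm ?_ ?_
  · calc volume (Iic (cdf (P.map X) x) ∩ Ioo 0 1)
        ≤ volume (Icc 0 (cdf (P.map X) x)) := measure_mono fun p hp => ⟨hp.2.1.le, hp.1⟩
      _ = _ := by simp
  · calc ENNReal.ofReal (cdf (P.map X) x) = volume (Ioo 0 (cdf (P.map X) x)) := by simp
      _ ≤ volume (Iic (cdf (P.map X) x) ∩ Ioo 0 1) :=
        measure_mono fun p hp => ⟨hp.2.le, hp.1, hp.2.trans_le h1⟩

lemma integrableOn_quantile (hX : Integrable X P) :
    IntegrableOn (quantile P X) (Ioo 0 1) := by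
  have h : Integrable id (P.map X) :=
    (integrable_map_measure aestronglyMeasurable_id hX.aemeasurable).2 hX
  rw [← map_quantile hX.aemeasurable] at h
  exact (integrable_map_measure aestronglyMeasurable_id (aemeasurable_quantile hX.aemeasurable)).1 h

lemma setIntegral_max_quantile (hX : AEMeasurable X P) (t : ℝ) :
    ∫ p in Ioo (0 : ℝ) 1, max (quantile P X p - t) 0 = ∫ ω, max (X ω - t) 0 ∂P := by
  have hg : Measurable fun x : ℝ => max (x - t) 0 := by fun_prop
  rw [← integral_map hX (f := fun x : ℝ => max (x - t) 0) hg.aestronglyMeasurable,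
    ← map_quantile hX, integral_map (aemeasurable_quantile hX) hg.aestronglyMeasurable]

lemma integrableOn_max_quantile (hX : Integrable X P) (t : ℝ) :
    IntegrableOn (fun p => max (quantile P X p - t) 0) (Ioo 0 1) :=
  ((integrableOn_quantile hX).sub (integrable_const t)).sup (integrable_const 0)

/-- Upper bound in the Rockafellar–Uryasev representation of the conditional value at risk. -/
lemma CVaR_le (hα0 : 0 < α) (hα : α < 1) (hX : Integrable X P) (t : ℝ) :
    CVaR P α X ≤ t + (1 / (1 - α)) * ∫ ω, max (X ω - t) 0 ∂P := by
  have hsub : Ioo α 1 ⊆ Ioo (0 : ℝ) 1 := Ioo_subset_Ioo_left hα0.le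
  have hmax := integrableOn_max_quantile hX t
  have h1 : ∫ p in Ioo α 1, quantile P X p
      ≤ ∫ p in Ioo α 1, (t + max (quantile P X p - t) 0) :=
    integral_mono ((integrableOn_quantile hX).mono_set hsub)
      ((integrable_const t).add (hmax.mono_set hsub))
      fun p => by
        have := le_max_left (quantile P X p - t) 0
        dsimp only
        linarith
  rw [integral_add (integrable_const t) (hmax.mono_set hsub), setIntegral_const_Ioo hα] at h1
  have h2 : ∫ p in Ioo α 1, max (quantile P X p - t) 0
      ≤ ∫ p in Ioo 0 1, max (quantile P X p - t) 0 :=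
    setIntegral_mono_set hmax (ae_of_all _ fun p => le_max_right _ _) hsub.eventuallyLE
  rw [setIntegral_max_quantile hX.aemeasurable] at h2
  have hpos : 0 < 1 - α := sub_pos.2 hα
  rw [CVaR_eq hα, one_div, inv_mul_le_iff₀ hpos, mul_add, mul_inv_cancel_left₀ hpos.ne']
  linarith

/-- The Rockafellar–Uryasev bound is attained at the value at risk. -/
lemma CVaR_eq_VaR_add (hα0 : 0 < α) (hα : α < 1) (hX : Integrable X P) :
    CVaR P α X
      = VaR P α X + (1 / (1 - α)) * ∫ ω, max (X ω - VaR P α X) 0 ∂P := by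
  have hsub : Ioo α 1 ⊆ Ioo (0 : ℝ) 1 := Ioo_subset_Ioo_left hα0.le
  have hmono := monotoneOn_quantile hX.aemeasurable
  set t := VaR P α X
  have h1 : ∫ p in Ioo α 1, quantile P X p
      = ∫ p in Ioo α 1, (t + max (quantile P X p - t) 0) := by
    refine setIntegral_congr_fun measurableSet_Ioo fun p hp => ?_
    have : t ≤ quantile P X p := hmono ⟨hα0, hα⟩ (hsub hp) hp.1.le
    simp [this]
  have h2 : ∫ p in Ioo α 1, max (quantile P X p - t) 0
      = ∫ p in Ioo 0 1, max (quantile P X p - t) 0 := by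
    refine (setIntegral_eq_of_subset_of_forall_sdiff_eq_zero measurableSet_Ioo hsub ?_).symm
    intro p hp
    have hpα : p ≤ α := by
      by_contra! h
      exact hp.2 ⟨h, hp.1.2⟩
    have : quantile P X p ≤ t := hmono hp.1 ⟨hα0, hα⟩ hpα
    simp [this]
  rw [integral_add (integrable_const t) ((integrableOn_max_quantile hX t).mono_set hsub),
    setIntegral_const_Ioo hα, h2, setIntegral_max_quantile hX.aemeasurable] at h1
  have hpos : 1 - α ≠ 0 := (sub_pos.2 hα).ne'
  rw [CVaR_eq hα, h1, one_div, mul_add, inv_mul_cancel_left₀ hpos]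

lemma CVaR_add_le (hα0 : 0 < α) (hα : α < 1) (hX : Integrable X P) (hY : Integrable Y P) :
    CVaR P α (fun ω => X ω + Y ω) ≤ CVaR P α X + CVaR P α Y := by
  have hle := CVaR_le hα0 hα (hX.add hY) (VaR P α X + VaR P α Y)
  have hintX : Integrable (fun ω => max (X ω - VaR P α X) 0) P :=
    (hX.sub (integrable_const _)).sup (integrable_const 0)
  have hintY : Integrable (fun ω => max (Y ω - VaR P α Y) 0) P :=
    (hY.sub (integrable_const _)).sup (integrable_const 0)
  have hint : ∫ ω, max ((X + Y) ω - (VaR P α X + VaR P α Y)) 0 ∂P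
      ≤ ∫ ω, max (X ω - VaR P α X) 0 ∂P + ∫ ω, max (Y ω - VaR P α Y) 0 ∂P := by
    rw [← integral_add hintX hintY]
    refine integral_mono (((hX.add hY).sub (integrable_const _)).sup (integrable_const 0))
      (hintX.add hintY) fun ω => ?_
    have hx := le_max_left (X ω - VaR P α X) 0
    have hx0 := le_max_right (X ω - VaR P α X) 0
    have hy := le_max_left (Y ω - VaR P α Y) 0
    have hy0 := le_max_right (Y ω - VaR P α Y) 0
    refine max_le ?_ (add_nonneg hx0 hy0)
    simp only [Pi.add_apply]
    linarith
  have hpos : 0 ≤ 1 / (1 - α) := (one_div_pos.2 (sub_pos.2 hα)).le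
  rw [CVaR_eq_VaR_add hα0 hα hX, CVaR_eq_VaR_add hα0 hα hY]
  refine hle.trans ?_
  linarith [mul_le_mul_of_nonneg_left hint hpos]

lemma VaR_le_CVaR {β : ℝ} (hβ : 0 < β) (hβα : β ≤ α) (hα : α < 1) (hX : Integrable X P) :
    VaR P β X ≤ CVaR P α X := by
  have hα0 := hβ.trans_le hβα
  have hint : 0 ≤ ∫ ω, max (X ω - VaR P α X) 0 ∂P := integral_nonneg fun ω => le_max_right _ _
  have hpos : 0 ≤ 1 / (1 - α) := (one_div_pos.2 (sub_pos.2 hα)).le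
  have hle : VaR P β X ≤ VaR P α X :=
    monotoneOn_quantile hX.aemeasurable ⟨hβ, hβα.trans_lt hα⟩ ⟨hα0, hα⟩ hβα
  rw [CVaR_eq_VaR_add hα0 hα hX]
  linarith [mul_nonneg hpos hint]

end Quantile

theorem slideVaR_subadditive_riskTail
    {Ω : Type*} [MeasurableSpace Ω] (P : Measure Ω) [IsProbabilityMeasure P]
    (α β : ℝ) (hβ : 0 < β) (hβα : β ≤ α) (hα : α < 1) (φ : ℝ → ℝ)
    (hφ0 : ∀ p ∈ Set.Ico (0:ℝ) β, φ p = 0)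
    (hφpos : ∀ p ∈ Set.Icc β 1, 0 ≤ φ p)
    (hφmono : MonotoneOn φ (Set.Icc β 1))
    (hφnorm : ∫ p in (0:ℝ)..1, φ p = 1)
    (S : ℝ → ℝ) (hS : Monotone S) (hS01 : ∀ x, S x ∈ Set.Icc (0:ℝ) 1)
    (X Y : Ω → ℝ) (hX : Integrable X P) (hY : Integrable Y P)
    (hSX : S (tailThickness P φ X) = 1) (hSY : S (tailThickness P φ Y) = 1) :
    SlideVaR P α β φ S (fun ω => X ω + Y ω)
      ≤ SlideVaR P α β φ S X + SlideVaR P α β φ S Y := by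
  have hVaR := VaR_le_CVaR hβ hβα hα (hX.add hY)
  have hCVaR := CVaR_add_le (hβ.trans_le hβα) hα hX hY
  obtain ⟨-, hs⟩ := hS01 (tailThickness P φ fun ω => X ω + Y ω)
  simp only [SlideVaR, hSX, hSY, one_mul, sub_self, zero_mul, add_zero]
  refine le_trans ?_ hCVaR
  have := mul_le_mul_of_nonneg_left hVaR (sub_nonneg.2 hs)
  simp only [Pi.add_def] at this
  linarith
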